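/- Assume condition (C_g)(a), c > 0, and d > d*. Let x⁺ be as in the standing definition, with t₁ the unique time with x⁺(t₁) = 1 on the increasing part and t₂ = t₁ + 1 + (1/c)·ln x⁺(t₁+1) the second time with x⁺(t₂) = 1. Then there exist m₀, m₁ with 0 < m₀ < 1 < m₁ ≤ d/c and σ > 0 such that m₀ ≤ x⁺(t) ≤ m₁ for all t ∈ ℝ, and for every T ≥ t₂ the interval [T, T+σ] contains at least one t with x⁺(t) = 1. -/

import Mathlib

open Real Set Filter Topology MeasureTheory

noncomputable section

/-- Condition `(C_g)(a)`: `g` maps `[0,∞)` into `[0,1]`, the restriction of `g` to `[0,1]`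
is `C¹` with derivative `g'` (one-sided at the endpoints), `g = 0` on `(1,∞)`,
`g 0 = g' 0 = 0`, `g 1 = 1`, and `g' ξ > g ξ / ξ` for all `ξ ∈ (0,1]`. -/
structure CgA (g g' : ℝ → ℝ) : Prop where
  maps_to : ∀ ξ : ℝ, 0 ≤ ξ → g ξ ∈ Icc (0:ℝ) 1
  hasDeriv : ∀ ξ ∈ Icc (0:ℝ) 1, HasDerivWithinAt g (g' ξ) (Icc (0:ℝ) 1) ξ
  derivCont : ContinuousOn g' (Icc (0:ℝ) 1)
  eq_zero : ∀ ξ : ℝ, 1 < ξ → g ξ = 0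
  g_zero : g 0 = 0
  g'_zero : g' 0 = 0
  g_one : g 1 = 1
  slope : ∀ ξ : ℝ, 0 < ξ → ξ ≤ 1 → g ξ / ξ < g' ξ

/-- `x` is a (nonnegative, continuous) solution on `ℝ` of the delay equation
`x'(t) = -a·x(t) + b·F(x(t-1))`, in integral form. -/
def IsSolR (a b : ℝ) (F x : ℝ → ℝ) : Prop :=
  Continuous x ∧ (∀ t : ℝ, 0 ≤ x t) ∧
    ∀ τ t : ℝ, τ < t →
      IntervalIntegrable (fun s => Real.exp (-a * (t - s)) * F (x (s - 1))) volume τ t ∧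
      x t = Real.exp (-a * (t - τ)) * x τ
          + b * ∫ s in τ..t, Real.exp (-a * (t - s)) * F (x (s - 1))

/-- `x` is a (nonnegative, continuous) solution on `[T₁ - 1, ∞)` of the delay equation
`x'(t) = -a·x(t) + b·F(x(t-1))`, in integral form (identity for `T₁ ≤ τ < t`). -/
def IsSolOn (a b : ℝ) (F : ℝ → ℝ) (T₁ : ℝ) (x : ℝ → ℝ) : Prop :=
  ContinuousOn x (Ici (T₁ - 1)) ∧ (∀ t : ℝ, T₁ - 1 ≤ t → 0 ≤ x t) ∧
    ∀ τ t : ℝ, T₁ ≤ τ → τ < t →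
      IntervalIntegrable (fun s => Real.exp (-a * (t - s)) * F (x (s - 1))) volume τ t ∧
      x t = Real.exp (-a * (t - τ)) * x τ
          + b * ∫ s in τ..t, Real.exp (-a * (t - s)) * F (x (s - 1))

/-- `z` is the solution of `(E_g)` on `[0,∞)` with initial segment `z t = e^{-c t}` on `[0,1]`. -/
def IsZSol (c d : ℝ) (g z : ℝ → ℝ) : Prop :=
  IsSolOn c d g 1 z ∧ ∀ t ∈ Icc (0:ℝ) 1, z t = Real.exp (-c * t)

/-- Condition `(C_{f_n})(a)(b)`: `a n → c`, `b n → d`, each `f n : [0,∞) → [0,1)` is `C¹`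
with derivative `f' n`, `f n 0 = 0`, `f' n > 0` on `(0,1/2]`, the uniform closeness of
`(f n, f' n)` to `(g, g')` away from `1`, and the smallness of
`sup_{[1+κ,∞)}|f' n| · (sup_{[0,∞)}|f' n|)^m`. -/
structure Cfn (c d : ℝ) (g g' : ℝ → ℝ) (a b : ℕ → ℝ) (f f' : ℕ → ℝ → ℝ) : Prop where
  a_pos : ∀ n, 0 < a n
  b_pos : ∀ n, 0 < b n
  a_lim : Tendsto a atTop (nhds c)
  b_lim : Tendsto b atTop (nhds d)
  maps_to : ∀ n, ∀ ξ : ℝ, 0 ≤ ξ → f n ξ ∈ Ico (0:ℝ) 1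
  hasDeriv : ∀ n, ∀ ξ : ℝ, 0 ≤ ξ → HasDerivWithinAt (f n) (f' n ξ) (Ici (0:ℝ)) ξ
  derivCont : ∀ n, ContinuousOn (f' n) (Ici (0:ℝ))
  f_zero : ∀ n, f n 0 = 0
  f'_pos : ∀ n, ∀ ξ : ℝ, 0 < ξ → ξ ≤ 1/2 → 0 < f' n ξ
  close : ∀ κ : ℝ, 0 < κ → κ < 1 → ∀ ε : ℝ, 0 < ε → ∃ N : ℕ, ∀ n ≥ N,
      ∀ ξ : ℝ, (ξ ∈ Icc (0:ℝ) (1 - κ) ∨ 1 + κ ≤ ξ) →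
        |f n ξ - g ξ| + |f' n ξ - g' ξ| < ε
  small : ∀ κ : ℝ, 0 < κ → κ < 1 → ∀ m : ℕ, ∃ A B : ℕ → ℝ,
      (∀ n, ∀ ξ : ℝ, 1 + κ ≤ ξ → |f' n ξ| ≤ A n) ∧
      (∀ n, ∀ ξ : ℝ, 0 ≤ ξ → |f' n ξ| ≤ B n) ∧
      Tendsto (fun n => A n * (B n) ^ m) atTop (nhds 0)

/-- Condition `(H)`. -/
structure CondH (a b ξm ξp : ℝ) (h : ℝ → ℝ) : Prop where
  a_pos : 0 < a
  b_pos : 0 < b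
  ξm_neg : ξm < 0
  ξp_pos : 0 < ξp
  bdd : ∃ M : ℝ, ∀ ξ : ℝ, |h ξ| ≤ M
  smooth : ContDiff ℝ 1 h
  h_zero : h 0 = 0
  slope_zero : a < b * deriv h 0
  zero_m : -a * ξm + b * h ξm = 0
  zero_p : -a * ξp + b * h ξp = 0
  ratio : ∀ ξ : ℝ, ξm < ξ → ξ < ξp → ξ ≠ 0 → a / b < h ξ / ξ
  deriv_pos : ∀ ξ : ℝ, ξ ≠ ξm → ξ ≠ ξp → 0 < deriv h ξ

/-- Solution of `(E_h)`: `u'(t) = -a·u(t) + b·h(u(t-1))` on all of `ℝ`. -/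
def IsSolH (a b : ℝ) (h u : ℝ → ℝ) : Prop :=
  ∀ t : ℝ, HasDerivAt u (-a * u t + b * h (u (t - 1))) t

/-- Solution of `(E_h)` on `[-1,∞)`: continuous there, differentiable on `(0,∞)`
and satisfying the equation for `t > 0`. -/
def IsSolHOn (a b : ℝ) (h u : ℝ → ℝ) : Prop :=
  ContinuousOn u (Ici (-1:ℝ)) ∧
    ∀ t : ℝ, 0 < t → HasDerivAt u (-a * u t + b * h (u (t - 1))) t

/-- Solution of `(E_h)` on `(-∞,0]`. -/
def IsSolHIic (a b : ℝ) (h u : ℝ → ℝ) : Prop :=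
  ContinuousOn u (Iic (0:ℝ)) ∧
    ∀ t : ℝ, t ≤ 0 → HasDerivWithinAt u (-a * u t + b * h (u (t - 1))) (Iic (0:ℝ)) t

theorem aux_h {g g' : ℝ → ℝ} (hg : CgA g g') :
    StrictMonoOn (fun ξ => g ξ / ξ) (Ioc (0:ℝ) 1) := by
  have hgc : ContinuousOn g (Icc (0:ℝ) 1) := fun ξ hξ => (hg.hasDeriv ξ hξ).continuousWithinAt
  apply strictMonoOn_of_deriv_pos (convex_Ioc 0 1)
  · apply ContinuousOn.div (hgc.mono Ioc_subset_Icc_self) continuousOn_id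
    intro x hx
    exact hx.1.ne'
  · intro x hx
    rw [interior_Ioc] at hx
    have h1 : HasDerivAt g (g' x) x :=
      (hg.hasDeriv x ⟨hx.1.le, hx.2.le⟩).hasDerivAt (Icc_mem_nhds hx.1 hx.2)
    have h2 := h1.div (hasDerivAt_id x) hx.1.ne'
    have h3 : deriv (fun ξ => g ξ / ξ) x = (g' x * x - g x * 1) / x ^ 2 := h2.deriv
    rw [h3]
    have := hg.slope x hx.1 hx.2.le
    rw [div_lt_iff₀ hx.1] at this
    have hx0 := hx.1
    apply div_pos (by linarith) (by positivity)

theorem aux_pos {g g' : ℝ → ℝ} (hg : CgA g g') {ξ : ℝ} (h0 : 0 < ξ) (h1 : ξ ≤ 1) : 0 < g ξ := by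
  have h := aux_h hg (show ξ/2 ∈ Ioc (0:ℝ) 1 from ⟨by linarith, by linarith⟩)
    (show ξ ∈ Ioc (0:ℝ) 1 from ⟨h0, h1⟩) (by linarith)
  have h2 : 0 ≤ g (ξ/2) / (ξ/2) := div_nonneg (hg.maps_to _ (by linarith)).1 (by linarith)
  have h3 : 0 < g ξ / ξ := lt_of_le_of_lt h2 h
  have := mul_pos h3 h0
  rwa [div_mul_cancel₀ _ h0.ne'] at this

theorem aux_scale {g g' : ℝ → ℝ} (hg : CgA g g') {ξ η Q : ℝ} (h0 : 0 ≤ ξ) (hQ : 1 ≤ Q)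
    (h : Q * ξ ≤ η) (h1 : η ≤ 1) : Q * g ξ ≤ g η := by
  rcases h0.eq_or_lt with h0 | h0
  · rw [← h0, hg.g_zero, mul_zero]
    rw [← h0, mul_zero] at h
    exact (hg.maps_to _ h).1
  have h2 : ξ ≤ η := by nlinarith
  have h3 := (aux_h hg).monotoneOn (show ξ ∈ Ioc (0:ℝ) 1 from ⟨h0, by linarith⟩)
    (show η ∈ Ioc (0:ℝ) 1 from ⟨by linarith, h1⟩) h2
  have h4 : g ξ / ξ ≤ g η / η := h3
  have e1 : g ξ = ξ * (g ξ / ξ) := by field_simp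
  have hη : 0 < η := by linarith
  have e2 : g η = η * (g η / η) := by field_simp
  have h5 : 0 ≤ g ξ / ξ := div_nonneg (hg.maps_to _ h0.le).1 h0.le
  rw [e1, e2]
  calc Q * (ξ * (g ξ / ξ)) = (Q * ξ) * (g ξ / ξ) := by ring
    _ ≤ η * (g ξ / ξ) := mul_le_mul_of_nonneg_right h h5
    _ ≤ _ := mul_le_mul_of_nonneg_left h4 hη.le

theorem aux_mono {g g' : ℝ → ℝ} (hg : CgA g g') {ξ η : ℝ} (h0 : 0 ≤ ξ)
    (h : ξ ≤ η) (h1 : η ≤ 1) : g ξ ≤ g η := by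
  simpa using aux_scale hg h0 le_rfl (by simpa using h) h1

theorem aux_expint (c τ t K : ℝ) (hc : 0 < c) :
    ∫ s in τ..t, Real.exp (-c * (t - s)) * K = K * (1 - Real.exp (-c * (t - τ))) / c := by
  have h : ∀ s ∈ uIcc τ t, HasDerivAt (fun s => Real.exp (-c * (t - s)) * K / c)
      (Real.exp (-c * (t - s)) * K) s := by
    intro s _
    have h1 : HasDerivAt (fun s => -c * (t - s)) (-c * (0 - 1)) s :=
      ((hasDerivAt_const s t).sub (hasDerivAt_id s)).const_mul (-c)
    have h2 := (h1.exp.mul_const K).div_const c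
    refine h2.congr_deriv ?_
    have hc' := hc.ne'
    field_simp
    ring
  rw [intervalIntegral.integral_eq_sub_of_hasDerivAt h
    (Continuous.intervalIntegrable (by fun_prop) _ _)]
  simp
  ring

theorem aux_upper {c d T : ℝ} {g x : ℝ → ℝ} (hc : 0 < c) (hd : 0 < d) (hx : IsSolOn c d g T x)
    {τ t K : ℝ} (hτ : T ≤ τ) (ht : τ ≤ t) (hK : ∀ s ∈ Icc τ t, g (x (s - 1)) ≤ K) :
    x t ≤ Real.exp (-c * (t - τ)) * x τ + d * (K * (1 - Real.exp (-c * (t - τ))) / c) := by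
  rcases ht.eq_or_lt with rfl | ht'
  · simp
  obtain ⟨hi, he⟩ := hx.2.2 τ t hτ ht'
  rw [he, ← aux_expint c τ t K hc]
  gcongr
  apply intervalIntegral.integral_mono_on ht hi (Continuous.intervalIntegrable (by fun_prop) _ _)
  intro s hs
  exact mul_le_mul_of_nonneg_left (hK s hs) (Real.exp_pos _).le

theorem aux_lower {c d T : ℝ} {g g' x : ℝ → ℝ} (hg : CgA g g') (hd : 0 < d)
    (hx : IsSolOn c d g T x)
    {τ t : ℝ} (hτ : T ≤ τ) (ht : τ ≤ t) :
    Real.exp (-c * (t - τ)) * x τ ≤ x t := by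
  rcases ht.eq_or_lt with rfl | ht'
  · simp
  obtain ⟨hi, he⟩ := hx.2.2 τ t hτ ht'
  rw [he]
  have : 0 ≤ ∫ s in τ..t, Real.exp (-c * (t - s)) * g (x (s - 1)) := by
    apply intervalIntegral.integral_nonneg ht
    intro s hs
    exact mul_nonneg (Real.exp_pos _).le (hg.maps_to _ (hx.2.1 _ (by linarith [hs.1]))).1
  have := mul_nonneg hd.le this
  linarith

theorem aux_comp {c d e L : ℝ} {g g' v w : ℝ → ℝ} (hg : CgA g g') (he : 0 < e) (hed : e ≤ d)
    (hv : IsSolOn c e g 1 v) (hw : IsSolOn c d g 1 w)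
    (h01 : ∀ t ∈ Icc (0:ℝ) 1, v t ≤ w t) (hL : ∀ t, 0 ≤ t → t ≤ L → w t ≤ 1) :
    ∀ t, 0 ≤ t → t ≤ L → v t ≤ w t := by
  have key : ∀ n : ℕ, ∀ t, 0 ≤ t → t ≤ L → t ≤ n + 1 → v t ≤ w t := by
    intro n
    induction n with
    | zero => 
      intro t h0 _ h1
      exact h01 t ⟨h0, by simpa using h1⟩
    | succ n ih =>
      intro t h0 hL' h1
      rcases le_or_gt t 1 with h | h
      · exact h01 t ⟨h0, h⟩
      push_cast at h1
      obtain ⟨i1, e1⟩ := hv.2.2 1 t le_rfl h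
      obtain ⟨i2, e2⟩ := hw.2.2 1 t le_rfl h
      have hI : ∫ s in (1:ℝ)..t, Real.exp (-c * (t - s)) * g (v (s - 1))
          ≤ ∫ s in (1:ℝ)..t, Real.exp (-c * (t - s)) * g (w (s - 1)) := by
        apply intervalIntegral.integral_mono_on h.le i1 i2
        intro s hs
        have := hs.1
        have := hs.2
        apply mul_le_mul_of_nonneg_left _ (Real.exp_pos _).le
        exact aux_mono hg (hv.2.1 _ (by linarith))
          (ih (s-1) (by linarith) (by linarith) (by linarith)) (hL _ (by linarith) (by linarith))
      have h0 : 0 ≤ ∫ s in (1:ℝ)..t, Real.exp (-c * (t - s)) * g (v (s - 1)) := by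
        apply intervalIntegral.integral_nonneg h.le
        intro s hs
        exact mul_nonneg (Real.exp_pos _).le (hg.maps_to _ (hv.2.1 _ (by linarith [hs.1]))).1
      rw [e1, e2]
      have h1 := mul_le_mul_of_nonneg_left (h01 1 (by simp)) (Real.exp_pos (-c * (t - 1))).le
      have h2 := mul_le_mul hed hI h0 (by linarith)
      linarith
  intro t h0 h1
  obtain ⟨n, hn⟩ := exists_nat_ge t
  exact key n t h0 h1 (by linarith)

theorem aux_decay {c e ε t₀ : ℝ} {g v : ℝ → ℝ} (hc : 0 < c) (he : 0 < e)
    (hv : IsSolOn c e g 1 v) (hε : 0 < ε)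
    (hs : ∀ ξ, 0 ≤ ξ → ξ ≤ ε → e * g ξ ≤ c / 2 * ξ) (ht₀ : 1 ≤ t₀)
    (hw : ∀ s ∈ Icc (t₀ - 1) t₀, v s ≤ ε) : Tendsto v atTop (nhds 0) := by
  have base : ∀ n : ℕ, ∀ t, t₀ - 1 ≤ t → t ≤ t₀ + n → v t ≤ ε := by
    intro n
    induction n with
    | zero =>
      intro t h0 h1
      exact hw t ⟨h0, by simpa using h1⟩
    | succ n ih =>
      intro t h0 h1
      rcases le_or_gt t t₀ with h | h
      · exact hw t ⟨h0, h⟩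
      push_cast at h1
      have hu := aux_upper (K := c / 2 * ε / e) hc he hv ht₀ h.le (by
        intro s hss
        have := hss.1
        have := hss.2
        have h2 := ih (s-1) (by linarith) (by linarith)
        have h3 := hs (v (s-1)) (hv.2.1 _ (by linarith)) h2
        rw [le_div_iff₀ he]
        nlinarith)
      have h4 := hw t₀ ⟨by linarith, le_rfl⟩
      have h5 : Real.exp (-c * (t - t₀)) ≤ 1 := by
        rw [Real.exp_le_one_iff]; nlinarith
      have h6 := Real.exp_pos (-c * (t - t₀))
      have h7 : e * (c / 2 * ε / e * (1 - Real.exp (-c * (t - t₀))) / c)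
        = ε / 2 * (1 - Real.exp (-c * (t - t₀))) := by field_simp
      rw [h7] at hu
      nlinarith
  have hE : Real.exp (-c) < 1 := by rw [Real.exp_lt_one_iff]; linarith
  have hEp := Real.exp_pos (-c)
  set ρ := (1 + Real.exp (-c)) / 2 with hρ
  have hρ1 : ρ < 1 := by linarith
  have hρ0 : 0 < ρ := by linarith
  have it : ∀ n : ℕ, ∀ t, t₀ - 1 + 2 * n ≤ t → v t ≤ ρ ^ n * ε := by
    intro n
    induction n with
    | zero =>
      intro t h
      obtain ⟨m, hm⟩ := exists_nat_ge (t - t₀)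
      simpa using base m t (by simpa using h) (by linarith)
    | succ n ih =>
      intro t h
      push_cast at h
      have hn : (0:ℝ) ≤ n := Nat.cast_nonneg n
      have hp : ρ ^ n ≤ 1 := pow_le_one₀ hρ0.le hρ1.le
      have hM : ρ ^ n * ε ≤ ε := by nlinarith
      have hu := aux_upper (τ := t - 1) (t := t) (K := c / 2 * (ρ ^ n * ε) / e) hc he hv
        (by linarith) (by linarith) (by
        intro s hss
        have := hss.1
        have := hss.2
        have h2 := ih (s-1) (by linarith)
        have h3 := hs (v (s-1)) (hv.2.1 _ (by linarith)) (by linarith)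
        rw [le_div_iff₀ he]
        nlinarith)
      have h4 := ih (t-1) (by linarith)
      have h8 : -c * (t - (t - 1)) = -c := by ring
      rw [h8] at hu
      have h7 : e * (c / 2 * (ρ ^ n * ε) / e * (1 - Real.exp (-c)) / c)
        = (ρ ^ n * ε) / 2 * (1 - Real.exp (-c)) := by field_simp
      rw [h7] at hu
      have h9 := mul_le_mul_of_nonneg_left h4 hEp.le
      rw [pow_succ]
      have : ρ ^ n * ρ * ε = (ρ ^ n * ε) * ((1 + Real.exp (-c)) / 2) := by rw [hρ]; ring
      rw [this]
      linarith
  rw [Metric.tendsto_atTop]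
  intro η hη
  obtain ⟨n, hn⟩ := exists_pow_lt_of_lt_one (div_pos hη hε) hρ1
  rw [lt_div_iff₀ hε] at hn
  refine ⟨t₀ - 1 + 2 * n, fun t ht => ?_⟩
  have h1 := it n t ht
  have h2 := hv.2.1 t (by have : (0:ℝ) ≤ n := Nat.cast_nonneg n
                          linarith)
  rw [Real.dist_eq, sub_zero, abs_of_nonneg h2]
  linarith

theorem aux_small {g g' : ℝ → ℝ} (hg : CgA g g') {k : ℝ} (hk : 0 < k) :
    ∃ ε, 0 < ε ∧ ε ≤ 1 ∧ ∀ ξ, 0 ≤ ξ → ξ ≤ ε → g ξ ≤ k * ξ := by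
  have h := hg.hasDeriv 0 (by simp)
  rw [hg.g'_zero, hasDerivWithinAt_iff_isLittleO] at h
  have h2 := h.def hk
  rw [eventually_nhdsWithin_iff, Metric.eventually_nhds_iff] at h2
  obtain ⟨r, hr, h3⟩ := h2
  refine ⟨min (r/2) 1, by positivity, min_le_right _ _, fun ξ h0 h1 => ?_⟩
  have hξr : ξ ≤ r / 2 := h1.trans (min_le_left _ _)
  have hξ1 : ξ ≤ 1 := h1.trans (min_le_right _ _)
  have h4 := h3 (y := ξ) (by rw [Real.dist_eq, sub_zero, abs_of_nonneg h0]; linarith) ⟨h0, hξ1⟩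
  simp [hg.g_zero, abs_of_nonneg h0] at h4
  exact (le_abs_self _).trans h4

theorem aux_key {c d e : ℝ} {g g' v w : ℝ → ℝ} (hg : CgA g g') (hc : 0 < c) (he : 0 < e)
    (hed : e < d) (hv : IsZSol c e g v) (hw : IsZSol c d g w)
    (hne : ¬ ((∀ t : ℝ, 0 < t → v t < 1) ∧ Tendsto v atTop (nhds 0))) :
    ∃ T, 0 < T ∧ 1 ≤ w T := by
  by_contra hcon
  push Not at hcon
  have hd : 0 < d := he.trans hed
  have hw1 : ∀ t, 0 ≤ t → w t ≤ 1 := by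
    intro t ht
    rcases ht.eq_or_lt with rfl | ht
    · rw [hw.2 0 (by simp)]; simp
    · exact (hcon t ht).le
  have hvw : ∀ t, 0 ≤ t → v t ≤ w t := fun t ht =>
    aux_comp (L := t) hg he hed.le hv.1 hw.1 (fun t ht => by rw [hv.2 t ht, hw.2 t ht])
      (fun t h0 _ => hw1 t h0) t ht le_rfl
  have hv0 : ¬ Tendsto v atTop (nhds 0) := fun h =>
    hne ⟨fun t ht => (hvw t ht.le).trans_lt (hcon t ht), h⟩
  obtain ⟨ε, hε, hε1, hsm⟩ := aux_small hg (show 0 < c / 2 / e by positivity)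
  have hwin : ∀ t, 1 ≤ t → ∃ s ∈ Icc (t-1) t, ε < v s := by
    intro t ht
    by_contra hh
    push Not at hh
    refine hv0 (aux_decay hc he hv.1 hε (fun ξ h0 h1 => ?_) ht hh)
    have := mul_le_mul_of_nonneg_left (hsm ξ h0 h1) he.le
    calc _ ≤ _ := this
      _ = _ := by field_simp
  set δ := Real.exp (-c) * ε with hδ
  have hδ0 : 0 < δ := by positivity
  have hδ1 : δ ≤ 1 := by
    have : Real.exp (-c) ≤ 1 := by rw [Real.exp_le_one_iff]; linarith
    nlinarith [Real.exp_pos (-c)]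
  have hvδ : ∀ t, 2 ≤ t → δ ≤ v t := by
    intro t ht
    obtain ⟨s, hs, hs2⟩ := hwin t (by linarith)
    have h1 := aux_lower hg he hv.1 (show 1 ≤ s by linarith [hs.1]) hs.2
    refine le_trans ?_ h1
    have : Real.exp (-c) ≤ Real.exp (-c * (t - s)) := by
      rw [Real.exp_le_exp]; nlinarith [hs.1, hs.2]
    exact mul_le_mul this hs2.le hε.le (Real.exp_pos _).le
  have hgδ := aux_pos hg hδ0 hδ1
  set θ := Real.exp (-c) * g δ with hθ
  have hθ0 : 0 < θ := by positivity
  set q := 1 + (d - e) * θ with hq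
  have hq1 : 1 < q := by have := mul_pos (sub_pos.2 hed) hθ0; linarith
  have it : ∀ n : ℕ, ∀ t : ℝ, 2 + 2 * n ≤ t → q ^ n * v t ≤ w t := by
    intro n
    induction n with
    | zero => intro t ht; simp at ht; simpa using hvw t (by linarith)
    | succ n ih =>
      intro t ht
      push_cast at ht
      have hn : (0:ℝ) ≤ n := Nat.cast_nonneg n
      have hQ : 1 ≤ q ^ n := one_le_pow₀ hq1.le
      obtain ⟨i1, e1⟩ := hv.1.2.2 (t-1) t (by linarith) (by linarith)
      obtain ⟨i2, e2⟩ := hw.1.2.2 (t-1) t (by linarith) (by linarith)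
      have hI : q ^ n * ∫ s in (t-1)..t, Real.exp (-c * (t - s)) * g (v (s - 1))
          ≤ ∫ s in (t-1)..t, Real.exp (-c * (t - s)) * g (w (s - 1)) := by
        rw [← intervalIntegral.integral_const_mul]
        apply intervalIntegral.integral_mono_on (by linarith) (i1.const_mul _) i2
        intro s hs
        have := hs.1
        have := hs.2
        have h1 := aux_scale hg (hv.1.2.1 (s-1) (by linarith)) hQ (ih (s-1) (by linarith))
          (hw1 _ (by linarith))
        have := mul_le_mul_of_nonneg_left h1 (Real.exp_pos (-c * (t - s))).le
        linarith
      have hJ : θ ≤ ∫ s in (t-1)..t, Real.exp (-c * (t - s)) * g (v (s - 1)) := by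
        have h0 : ∫ s in (t-1)..t, θ = θ := by simp
        rw [← h0]
        apply intervalIntegral.integral_mono_on (by linarith) (by simp) i1
        intro s hs
        have := hs.1
        have := hs.2
        have h1 : g δ ≤ g (v (s-1)) := aux_mono hg hδ0.le (hvδ _ (by linarith))
          ((hvw _ (by linarith)).trans (hw1 _ (by linarith)))
        have h2 : Real.exp (-c) ≤ Real.exp (-c * (t - s)) := by
          rw [Real.exp_le_exp]; nlinarith
        exact mul_le_mul h2 h1 hgδ.le (Real.exp_pos _).le
      set I := ∫ s in (t-1)..t, Real.exp (-c * (t - s)) * g (v (s - 1)) with hIdef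
      set J := ∫ s in (t-1)..t, Real.exp (-c * (t - s)) * g (w (s - 1)) with hJdef
      have hv1 : v t ≤ 1 := (hvw _ (by linarith)).trans (hw1 _ (by linarith))
      have h8 := mul_le_mul_of_nonneg_left (ih (t-1) (by linarith))
        (Real.exp_pos (-c * (t - (t-1)))).le
      have h9 := mul_le_mul_of_nonneg_left hI hd.le
      have h10 : θ * v t ≤ I := by nlinarith
      have h11 : (d - e) * θ * v t ≤ (d - e) * I := by
        have := mul_le_mul_of_nonneg_left h10 (sub_pos.2 hed).le
        linarith
      have h12 : q * v t ≤ Real.exp (-c * (t - (t-1))) * v (t-1) + d * I := by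
        have : q * v t = v t + (d - e) * θ * v t := by rw [hq]; ring
        rw [this]; linarith
      have h13 := mul_le_mul_of_nonneg_left h12 (zero_le_one.trans hQ)
      rw [e2, pow_succ]
      linarith
  obtain ⟨n, hn⟩ := pow_unbounded_of_one_lt (1 / δ) hq1
  rw [div_lt_iff₀ hδ0] at hn
  have hnn : (0:ℝ) ≤ n := Nat.cast_nonneg n
  have h1 := it n (2 + 2 * n) le_rfl
  have h2 := hvδ (2 + 2 * n) (by linarith)
  have h3 := hw1 (2 + 2 * n) (by linarith)
  have h4 := mul_le_mul_of_nonneg_left h2 (show 0 ≤ q ^ n by positivity)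
  linarith

theorem aux_solR {c d : ℝ} {g x : ℝ → ℝ} (hx : IsSolR c d g x) (T : ℝ) : IsSolOn c d g T x :=
  ⟨hx.1.continuousOn, fun t _ => hx.2.1 t, fun τ t _ h => hx.2.2 τ t h⟩

theorem aux_shift {c d : ℝ} {g x : ℝ → ℝ} (hx : IsSolR c d g x) (r : ℝ) :
    IsSolR c d g (fun t => x (t + r)) := by
  refine ⟨hx.1.comp (by fun_prop), fun t => hx.2.1 _, fun τ t h => ?_⟩
  obtain ⟨i, e⟩ := hx.2.2 (τ + r) (t + r) (by linarith)
  have hf : (fun s => Real.exp (-c * (t - s)) * g (x (s - 1 + r)))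
      = fun s => (fun u => Real.exp (-c * (t + r - u)) * g (x (u - 1))) (s + r) := by
    funext s
    simp only
    congr 3
    · ring
    · ring_nf
  constructor
  · simp only
    rw [hf]
    simpa using i.comp_add_right r
  · simp only
    rw [hf, intervalIntegral.integral_comp_add_right
      (fun u => Real.exp (-c * (t + r - u)) * g (x (u - 1))), e]
    congr 3
    ring_nf

/-- for `d > d*`, the solution `x⁺` stays in a band `[m₀, m₁]` with
`0 < m₀ < 1 < m₁ ≤ d/c`, and every interval `[T, T+σ]` with `T ≥ t₂` contains a time
where `x⁺` takes the value `1`. -/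
theorem stmt_14 (c d dstar : ℝ) (g g' : ℝ → ℝ) (hg : CgA g g') (hc : 0 < c)
    (z : ℝ → ℝ → ℝ) (hz : ∀ e : ℝ, c < e → IsZSol c e g (z e))
    (hds : c < dstar)
    (hD : {e : ℝ | c < e ∧ (∀ t : ℝ, 0 < t → z e t < 1) ∧ Tendsto (z e) atTop (nhds 0)}
        = Ioo c dstar)
    (hd : dstar < d)
    (ξ₁ κp : ℝ) (hξ₁ : ξ₁ ∈ Ioo (0:ℝ) 1) (hz₁ : -c * ξ₁ + d * g ξ₁ = 0)
    (hκp : κp ∈ Ioo 0 (1 - ξ₁))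
    (xp : ℝ → ℝ) (hxp : IsSolR c d g xp) (hxp0 : xp 0 = ξ₁ + κp)
    (hxpb : ∀ t : ℝ, t ≤ 0 → ξ₁ ≤ xp t ∧ xp t ≤ xp 0)
    (t₁ t₂ : ℝ) (ht₁ : 0 < t₁) (hxt₁ : xp t₁ = 1)
    (hmono : StrictMonoOn xp (Iic (t₁ + 1)))
    (ht₂ : t₂ = t₁ + 1 + (1 / c) * Real.log (xp (t₁ + 1))) (hxt₂ : xp t₂ = 1) :
    ∃ m₀ m₁ σ : ℝ, 0 < m₀ ∧ m₀ < 1 ∧ 1 < m₁ ∧ m₁ ≤ d / c ∧ 0 < σ ∧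
      (∀ t : ℝ, m₀ ≤ xp t ∧ xp t ≤ m₁) ∧
      ∀ T : ℝ, t₂ ≤ T → ∃ t ∈ Icc T (T + σ), xp t = 1 := by
  have hcd : c < d := hds.trans hd
  have hd0 : 0 < d := hc.trans hcd
  have hdc : 1 < d / c := by rwa [one_lt_div hc]
  obtain ⟨T₁, hT₁, hzT⟩ := aux_key hg hc (hc.trans hds) hd (hz dstar hds) (hz d hcd) (by
    intro h
    have h1 : dstar ∈ Ioo c dstar := by
      rw [← hD]; exact ⟨hds, h⟩
    exact lt_irrefl _ h1.2)
  have hcont := hxp.1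
  have hnn := hxp.2.1
  have hup : ∀ t, xp t ≤ d / c := by
    have h0 : ∀ t, t ≤ 0 → xp t ≤ d / c := fun t ht => by
      have := (hxpb t ht).2
      have := hκp.2
      linarith
    intro t
    rcases le_or_gt t 0 with ht | ht
    · exact h0 t ht
    have h1 := aux_upper (K := 1) hc hd0 (aux_solR hxp 0) le_rfl ht.le
      (fun s _ => (hg.maps_to _ (hnn _)).2)
    have h2 := mul_le_mul_of_nonneg_left (h0 0 le_rfl) (Real.exp_pos (-c * (t - 0))).le
    have h3 : d * (1 * (1 - Real.exp (-c * (t - 0))) / c)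
      = d / c - Real.exp (-c * (t - 0)) * (d / c) := by field_simp
    linarith
  have hlow : ∀ τ t, τ ≤ t → Real.exp (-c * (t - τ)) * xp τ ≤ xp t := fun τ t h =>
    aux_lower hg hd0 (aux_solR hxp τ) le_rfl h
  have hlog : 0 < Real.log (d / c) := Real.log_pos hdc
  set σ := 1 + T₁ + Real.log (d / c) / c with hσ
  have hlc : 0 < Real.log (d / c) / c := by positivity
  have hσ0 : 0 < σ := by linarith
  have hit : ∀ T : ℝ, t₂ ≤ T → ∃ t ∈ Icc T (T + σ), xp t = 1 := by
    intro T hT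
    by_contra hno
    push Not at hno
    rcases le_or_gt 1 (xp T) with h1 | h1
    · have hgt : ∀ t ∈ Icc T (T + σ), 1 < xp t := by
        intro t ht
        by_contra hle
        push Not at hle
        obtain ⟨s, hs, hs1⟩ := intermediate_value_Icc' ht.1 hcont.continuousOn ⟨hle, h1⟩
        exact hno s ⟨hs.1, hs.2.trans ht.2⟩ hs1
      have h2 := aux_upper (K := 0) (τ := T + 1) (t := T + σ) hc hd0 (aux_solR hxp (T + 1)) le_rfl
        (by linarith) (fun s hs => (hg.eq_zero _ (hgt _
          ⟨by linarith [hs.1], by linarith [hs.2]⟩)).le)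
      have h3 := hgt (T + σ) ⟨by linarith, le_rfl⟩
      have h4 : Real.exp (-c * (T + σ - (T + 1))) ≤ c / d := by
        have : c / d = Real.exp (-Real.log (d / c)) := by
          rw [Real.exp_neg, Real.exp_log (by positivity), inv_div]
        rw [this, Real.exp_le_exp]
        have : -Real.log (d / c) = -c * (Real.log (d / c) / c) := by field_simp
        rw [this]
        nlinarith
      have h5 := mul_le_mul h4 (hup (T + 1)) (hnn _) (by positivity)
      have h6 : c / d * (d / c) = 1 := by field_simp
      simp at h2 h5
      linarith
    · have hS : IsCompact (Icc t₂ T ∩ xp ⁻¹' {1}) :=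
        isCompact_Icc.inter_right (isClosed_singleton.preimage hcont)
      obtain ⟨τ, hτ⟩ := hS.exists_isGreatest ⟨t₂, ⟨le_rfl, hT⟩, hxt₂⟩
      have hτ1 : xp τ = 1 := hτ.1.2
      have hτT : τ ≤ T := hτ.1.1.2
      have hlt : ∀ t, τ < t → t ≤ T + σ → xp t < 1 := by
        intro t ht ht'
        by_contra hge
        push Not at hge
        rcases le_total t T with h | h
        · obtain ⟨s, hs, hs1⟩ := intermediate_value_Icc' h hcont.continuousOn ⟨h1.le, hge⟩
          have := hτ.2 ⟨⟨by linarith [hτ.1.1.1, hs.1], hs.2⟩, hs1⟩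
          linarith [hs.1]
        · obtain ⟨s, hs, hs1⟩ := intermediate_value_Icc h hcont.continuousOn ⟨h1.le, hge⟩
          exact hno s ⟨hs.1, hs.2.trans ht'⟩ hs1
      have hle : ∀ t, 0 ≤ t → t ≤ T₁ → xp (t + τ) ≤ 1 := by
        intro t h0 h2
        rcases h0.eq_or_lt with rfl | h0
        · simp [hτ1]
        · exact (hlt _ (by linarith) (by linarith)).le
      have hc1 := aux_comp (L := T₁) hg hd0 le_rfl (hz d hcd).1 (aux_solR (aux_shift hxp τ) 1)
        (by
          intro t ht
          rw [(hz d hcd).2 t ht]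
          have := hlow τ (t + τ) (by linarith [ht.1])
          simpa [hτ1] using this) hle T₁ hT₁.le le_rfl
      have := hlt (T₁ + τ) (by linarith) (by linarith)
      linarith
  refine ⟨min (Real.exp (-c * σ)) (min ξ₁ (Real.exp (-c * t₂) * ξ₁)), d / c, σ, ?_, ?_, hdc, le_rfl,
    hσ0, fun t => ⟨?_, hup t⟩, hit⟩
  · have := hξ₁.1
    positivity
  · exact lt_of_le_of_lt ((min_le_right _ _).trans (min_le_left _ _)) hξ₁.2
  · rcases le_or_gt t 0 with h | h
    · exact ((min_le_right _ _).trans (min_le_left _ _)).trans (hxpb t h).1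
    rcases le_or_gt t t₂ with h2 | h2
    · refine ((min_le_right _ _).trans (min_le_right _ _)).trans ?_
      refine le_trans ?_ (hlow 0 t h.le)
      have : Real.exp (-c * t₂) ≤ Real.exp (-c * (t - 0)) := by
        rw [Real.exp_le_exp]; nlinarith
      exact mul_le_mul this (hxpb 0 le_rfl).1 hξ₁.1.le (Real.exp_pos _).le
    · refine (min_le_left _ _).trans ?_
      have : ∃ τ, τ ≤ t ∧ t - σ ≤ τ ∧ xp τ = 1 := by
        rcases le_or_gt t₂ (t - σ) with h3 | h3
        · obtain ⟨τ, hτ, h4⟩ := hit (t - σ) h3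
          exact ⟨τ, by linarith [hτ.2], hτ.1, h4⟩
        · exact ⟨t₂, h2.le, h3.le, hxt₂⟩
      obtain ⟨τ, h4, h5, h6⟩ := this
      have h7 := hlow τ t h4
      rw [h6, mul_one] at h7
      refine le_trans ?_ h7
      rw [Real.exp_le_exp]; nlinarith
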